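/- arXiv:0910.2127 — 2 statements merged into one kernel-verified Lean document; each statement's English description precedes it below -/
import Mathlib

section
/- The map Ψ is a well-defined bijection from L₁ onto L₂, and it preserves square norms: Q(Ψ(x)) = Q(x) for every x ∈ L₁ and all real numbers a, b, c, d. -/
/-- The diagonal quadratic form `Q(x) = a x₀² + b x₁² + c x₂² + d x₃²` on `ℤ⁴`. -/
def Q (a b c d : ℝ) (x : Fin 4 → ℤ) : ℝ :=
  a * (x 0 : ℝ) ^ 2 + b * (x 1 : ℝ) ^ 2 + c * (x 2 : ℝ) ^ 2 + d * (x 3 : ℝ) ^ 2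

/-- The associated symmetric bilinear form on `ℤ⁴`. -/
def B (a b c d : ℝ) (x y : Fin 4 → ℤ) : ℝ :=
  a * (x 0 : ℝ) * (y 0 : ℝ) + b * (x 1 : ℝ) * (y 1 : ℝ) +
    c * (x 2 : ℝ) * (y 2 : ℝ) + d * (x 3 : ℝ) * (y 3 : ℝ)

def l0 : Fin 4 → ℤ := ![-1, 3, -1, 1]
def l1 : Fin 4 → ℤ := ![1, -1, -1, 3]
def l2 : Fin 4 → ℤ := ![-1, -1, 1, 3]
def l3 : Fin 4 → ℤ := ![-1, 1, -1, 3]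

/-- `L₁ = span_ℤ {l₀, l₁, 3 l₂, 3 l₃}`. -/
def L1 : Submodule ℤ (Fin 4 → ℤ) :=
  Submodule.span ℤ {l0, l1, (3 : ℤ) • l2, (3 : ℤ) • l3}

/-- `L₂ = span_ℤ {l₀, 3 l₁, l₂, 3 l₃}`. -/
def L2 : Submodule ℤ (Fin 4 → ℤ) :=
  Submodule.span ℤ {l0, (3 : ℤ) • l1, l2, (3 : ℤ) • l3}

/-- `M = span_ℤ {(−3,3,3,3), (3,−3,3,3), (3,3,−3,3), (3,3,3,−3)}`. -/
def M : Submodule ℤ (Fin 4 → ℤ) :=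
  Submodule.span ℤ {![-3, 3, 3, 3], ![3, -3, 3, 3], ![3, 3, -3, 3], ![3, 3, 3, -3]}

/-- The coset representatives `v₀, v₁, v₂, v₃` of `L₁/M`. -/
def v : Fin 4 → (Fin 4 → ℤ) :=
  ![![-1, 3, -1, 1], ![1, -1, -1, 3], ![3, 1, -1, -1], ![-1, -1, -3, -1]]

/-- The Kleinian four group elements `g₀ = id`, `g₁ = diag(−1,1,−1,1)`,
`g₂ = diag(−1,−1,1,1)`, `g₃ = diag(1,−1,−1,1)` acting diagonally on `ℤ⁴`. -/
def g : Fin 4 → (Fin 4 → ℤ) → (Fin 4 → ℤ) :=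
  ![fun x => x,
    fun x => ![-(x 0), x 1, -(x 2), x 3],
    fun x => ![-(x 0), -(x 1), x 2, x 3],
    fun x => ![x 0, -(x 1), -(x 2), x 3]]

open Classical in
/-- The Conway–Sloane bijection `Ψ : L₁ → L₂`, given by `Ψ(m) = m` for `m ∈ M` and
`Ψ(m ± vᵢ) = gᵢ(m ± vᵢ)`  (note `g₀ = id`, so the classes `[0], [±v₀]` are fixed). -/
noncomputable def Psi (x : Fin 4 → ℤ) : Fin 4 → ℤ :=
  if x - v 1 ∈ M ∨ x + v 1 ∈ M then g 1 x
  else if x - v 2 ∈ M ∨ x + v 2 ∈ M then g 2 x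
  else if x - v 3 ∈ M ∨ x + v 3 ∈ M then g 3 x
  else x

theorem mem_span_four {w₀ w₁ w₂ w₃ x : Fin 4 → ℤ} :
    x ∈ Submodule.span ℤ {w₀, w₁, w₂, w₃} ↔
      ∃ p q r s : ℤ, ∀ i, p * w₀ i + q * w₁ i + r * w₂ i + s * w₃ i = x i := by
  simp only [Submodule.mem_span_insert, Submodule.mem_span_singleton]
  constructor
  · rintro ⟨p, _, ⟨q, _, ⟨r, _, ⟨s, rfl⟩, rfl⟩, rfl⟩, rfl⟩
    exact ⟨p, q, r, s, fun i => by simp; ring⟩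
  · rintro ⟨p, q, r, s, h⟩
    exact ⟨p, _, ⟨q, _, ⟨r, _, ⟨s, rfl⟩, rfl⟩, rfl⟩, by ext i; simp [← h i]; ring⟩

/-- Membership in the lattice spanned by `l₀, l₁, l₂, l₃`, which is also spanned by `(−1,1,1,1)`
and its permutations. -/
def InParityLattice (x : Fin 4 → ℤ) : Prop :=
  2 ∣ x 0 - x 1 ∧ 2 ∣ x 0 - x 2 ∧ 2 ∣ x 0 - x 3 ∧ 4 ∣ x 1 + x 2 + x 3 - x 0

theorem mem_M_iff {x : Fin 4 → ℤ} :
    x ∈ M ↔ InParityLattice x ∧ 3 ∣ x 0 ∧ 3 ∣ x 1 ∧ 3 ∣ x 2 ∧ 3 ∣ x 3 := by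
  simp only [M, mem_span_four, InParityLattice, Fin.forall_fin_succ]
  simp
  constructor
  · rintro ⟨p, q, r, s, h⟩
    omega
  · intro h
    have h₀ : 12 ∣ x 1 + x 2 + x 3 - x 0 := by omega
    have h₁ : 12 ∣ x 0 + x 2 + x 3 - x 1 := by omega
    have h₂ : 12 ∣ x 0 + x 1 + x 3 - x 2 := by omega
    have h₃ : 12 ∣ x 0 + x 1 + x 2 - x 3 := by omega
    clear h
    exact ⟨(x 1 + x 2 + x 3 - x 0) / 12, (x 0 + x 2 + x 3 - x 1) / 12,
      (x 0 + x 1 + x 3 - x 2) / 12, (x 0 + x 1 + x 2 - x 3) / 12, by omega⟩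

theorem mem_L1_iff {x : Fin 4 → ℤ} :
    x ∈ L1 ↔ InParityLattice x ∧ 3 ∣ x 0 + x 1 + x 3 ∧ 3 ∣ x 2 + x 3 - x 1 := by
  simp only [L1, mem_span_four, InParityLattice, Fin.forall_fin_succ, l0, l1, l2, l3]
  simp
  constructor
  · rintro ⟨p, q, r, s, h⟩
    omega
  · intro h
    exact ⟨(3 * x 0 + 3 * x 1 + 3 * x 2 + x 3) / 4, (3 * x 0 + x 1 + x 2 + x 3) / 4,
      (x 0 + x 1 + 3 * x 2 + x 3) / 12, (-5 * x 0 - 3 * x 1 - 5 * x 2 - x 3) / 12, by omega⟩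

theorem mem_L2_iff {x : Fin 4 → ℤ} :
    x ∈ L2 ↔ InParityLattice x ∧ 3 ∣ x 0 - x 1 + x 3 ∧ 3 ∣ x 1 + x 2 + x 3 := by
  simp only [L2, mem_span_four, InParityLattice, Fin.forall_fin_succ, l0, l1, l2, l3]
  simp
  constructor
  · rintro ⟨p, q, r, s, h⟩
    omega
  · intro h
    exact ⟨(3 * x 0 + 3 * x 1 + 3 * x 2 + x 3) / 4, (3 * x 0 + x 1 + x 2 + x 3) / 12,
      (x 0 + x 1 + 3 * x 2 + x 3) / 4, (-5 * x 0 - 3 * x 1 - 5 * x 2 - x 3) / 12, by omega⟩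

/-- The map agreeing with `Ψ` on `L₁` and with `Ψ⁻¹` on `L₂`: the sign change is chosen according
to which coordinates are divisible by `3`. -/
def tetracodeFlip (x : Fin 4 → ℤ) : Fin 4 → ℤ :=
  if 3 ∣ x 3 ∧ ¬3 ∣ x 0 then g 1 x
  else if 3 ∣ x 0 ∧ ¬3 ∣ x 3 then g 2 x
  else if 3 ∣ x 2 ∧ ¬3 ∣ x 0 then g 3 x
  else x

theorem InParityLattice.add {x y : Fin 4 → ℤ} (hx : InParityLattice x) (hy : InParityLattice y) :
    InParityLattice (x + y) := by
  simp only [InParityLattice, Pi.add_apply] at *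
  omega

theorem InParityLattice.sub {x y : Fin 4 → ℤ} (hx : InParityLattice x) (hy : InParityLattice y) :
    InParityLattice (x - y) := by
  simp only [InParityLattice, Pi.sub_apply] at *
  omega

theorem inParityLattice_v (i : Fin 4) : InParityLattice (v i) := by
  fin_cases i <;> simp [InParityLattice, v]

theorem InParityLattice.g {x : Fin 4 → ℤ} (hx : InParityLattice x) (i : Fin 4) :
    InParityLattice (g i x) := by
  unfold InParityLattice at hx
  fin_cases i <;> simp [InParityLattice, _root_.g] <;> omega

theorem InParityLattice.tetracodeFlip {x : Fin 4 → ℤ} (hx : InParityLattice x) :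
    InParityLattice (tetracodeFlip x) := by
  unfold _root_.tetracodeFlip
  split_ifs
  exacts [hx.g 1, hx.g 2, hx.g 3, hx]

theorem Psi_eq_tetracodeFlip {x : Fin 4 → ℤ} (hx : x ∈ L1) : Psi x = tetracodeFlip x := by
  obtain ⟨hp, ht, ht'⟩ := mem_L1_iff.1 hx
  have hM (i : Fin 4) : x - v i ∈ M ∨ x + v i ∈ M ↔
      (3 ∣ x 0 - v i 0 ∧ 3 ∣ x 1 - v i 1 ∧ 3 ∣ x 2 - v i 2 ∧ 3 ∣ x 3 - v i 3) ∨
      (3 ∣ x 0 + v i 0 ∧ 3 ∣ x 1 + v i 1 ∧ 3 ∣ x 2 + v i 2 ∧ 3 ∣ x 3 + v i 3) := by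
    simp [mem_M_iff, hp.sub (inParityLattice_v i), hp.add (inParityLattice_v i)]
  have h₁ : x - v 1 ∈ M ∨ x + v 1 ∈ M ↔ 3 ∣ x 3 ∧ ¬3 ∣ x 0 := by
    rw [hM]
    simp only [v, Matrix.cons_val]
    clear hM hp
    constructor
    · omega
    · rintro ⟨h3, h0⟩
      obtain h | h : x 0 % 3 = 1 ∨ x 0 % 3 = 2 := by omega
      · exact Or.inl (by omega)
      · exact Or.inr (by omega)
  have h₂ : x - v 2 ∈ M ∨ x + v 2 ∈ M ↔ 3 ∣ x 0 ∧ ¬3 ∣ x 3 := by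
    rw [hM]
    simp only [v, Matrix.cons_val]
    clear hM hp
    constructor
    · omega
    · rintro ⟨h0, h3⟩
      obtain h | h : x 3 % 3 = 2 ∨ x 3 % 3 = 1 := by omega
      · exact Or.inl (by omega)
      · exact Or.inr (by omega)
  have h₃ : x - v 3 ∈ M ∨ x + v 3 ∈ M ↔ 3 ∣ x 2 ∧ ¬3 ∣ x 0 := by
    rw [hM]
    simp only [v, Matrix.cons_val]
    clear hM hp
    constructor
    · omega
    · rintro ⟨h2, h0⟩
      obtain h | h : x 0 % 3 = 2 ∨ x 0 % 3 = 1 := by omega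
      · exact Or.inl (by omega)
      · exact Or.inr (by omega)
  simp only [Psi, tetracodeFlip, h₁, h₂, h₃]

theorem emod_three_cases (n : ℤ) : n % 3 = 0 ∨ n % 3 = 1 ∨ n % 3 = 2 := by
  omega

theorem tetracodeFlip_mem_L2 {x : Fin 4 → ℤ} (hx : x ∈ L1) : tetracodeFlip x ∈ L2 := by
  obtain ⟨hp, ht, ht'⟩ := mem_L1_iff.1 hx
  refine mem_L2_iff.2 ⟨hp.tetracodeFlip, ?_⟩
  unfold tetracodeFlip
  split_ifs <;> try simp only [g, Matrix.cons_val]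
  all_goals
    rcases emod_three_cases (x 0) with h0 | h0 | h0 <;>
      rcases emod_three_cases (x 3) with h3 | h3 | h3 <;> omega

theorem tetracodeFlip_mem_L1 {x : Fin 4 → ℤ} (hx : x ∈ L2) : tetracodeFlip x ∈ L1 := by
  obtain ⟨hp, ht, ht'⟩ := mem_L2_iff.1 hx
  refine mem_L1_iff.2 ⟨hp.tetracodeFlip, ?_⟩
  unfold tetracodeFlip
  split_ifs <;> try simp only [g, Matrix.cons_val]
  all_goals
    rcases emod_three_cases (x 0) with h0 | h0 | h0 <;>
      rcases emod_three_cases (x 3) with h3 | h3 | h3 <;> omega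

theorem tetracodeFlip_involutive : Function.Involutive tetracodeFlip := by
  intro x
  by_cases h₁ : 3 ∣ x 3 ∧ ¬3 ∣ x 0
  · ext i; fin_cases i <;> simp [tetracodeFlip, g, h₁]
  by_cases h₂ : 3 ∣ x 0 ∧ ¬3 ∣ x 3
  · ext i; fin_cases i <;> simp [tetracodeFlip, g, h₂]
  by_cases h₃ : 3 ∣ x 2 ∧ ¬3 ∣ x 0
  · have h₄ : ¬3 ∣ x 3 := fun h => h₁ ⟨h, h₃.2⟩
    ext i; fin_cases i <;> simp [tetracodeFlip, g, h₃, h₄]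
  · simp only [tetracodeFlip, h₁, h₂, h₃, if_false]

theorem Q_tetracodeFlip (a b c d : ℝ) (x : Fin 4 → ℤ) :
    Q a b c d (tetracodeFlip x) = Q a b c d x := by
  unfold tetracodeFlip
  split_ifs <;> simp [Q, g]

/-- `Ψ` is a well-defined bijection from `L₁` onto `L₂` preserving square norms. -/
theorem psi_bijective_norm_preserving :
    Set.BijOn Psi (L1 : Set (Fin 4 → ℤ)) (L2 : Set (Fin 4 → ℤ)) ∧
    ∀ a b c d : ℝ, ∀ x ∈ L1, Q a b c d (Psi x) = Q a b c d x := by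
  refine ⟨?_, fun a b c d x hx => by rw [Psi_eq_tetracodeFlip hx, Q_tetracodeFlip]⟩
  have hflip : Set.BijOn tetracodeFlip L1 L2 :=
    Set.InvOn.bijOn ⟨fun x _ => tetracodeFlip_involutive x, fun x _ => tetracodeFlip_involutive x⟩
      (fun _ => tetracodeFlip_mem_L2) (fun _ => tetracodeFlip_mem_L1)
  exact hflip.congr fun _ hx => (Psi_eq_tetracodeFlip hx).symm
end

section
/- An element w of the coset v₁ + M is minimal with respect to ≺ (i.e., there is no w' ∈ v₁ + M with w' ≺ w) if and only if w = v₁ = (1,−1,−1,3) or w = v₅ = (4,2,2,0). -/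
/-- The partial preorder `≼` on `ℕ⁴`: `n ≼ n'` iff `Σ_{i ≥ i₀} nᵢ ≤ Σ_{i ≥ i₀} n'ᵢ`
for every `i₀`. -/
def preceq (n n' : Fin 4 → ℕ) : Prop :=
  ∀ i0 : Fin 4, ∑ i ∈ Finset.univ.filter (fun i => i0 ≤ i), n i ≤
    ∑ i ∈ Finset.univ.filter (fun i => i0 ≤ i), n' i

/-- The strict relation `≺`: `n ≺ n'` iff `n ≼ n'` but not `n' ≼ n`. -/
def precl (n n' : Fin 4 → ℕ) : Prop := preceq n n' ∧ ¬ preceq n' n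

/-- `φ : ℤ⁴ → ℕ⁴`, `φ(x) = (x₀², x₁², x₂², x₃²)`. -/
def phi (x : Fin 4 → ℤ) : Fin 4 → ℕ := fun i => (x i).natAbs ^ 2

theorem sub_v_one_mem_M_iff (w : Fin 4 → ℤ) :
    w - v 1 ∈ M ↔ ∃ a b c d : ℤ, w 0 = 1 + 3 * (-a + b + c + d) ∧
      w 1 = -1 + 3 * (a - b + c + d) ∧ w 2 = -1 + 3 * (a + b - c + d) ∧
      w 3 = 3 + 3 * (a + b + c - d) := by
  simp only [M, Submodule.mem_span_insert, Submodule.mem_span_singleton, v]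
  constructor
  · rintro ⟨a, _, ⟨b, _, ⟨c, _, ⟨d, rfl⟩, rfl⟩, rfl⟩, h⟩
    refine ⟨a, b, c, d, ?_, ?_, ?_, ?_⟩
    · have := congrFun h 0
      simp at this
      linarith
    · have := congrFun h 1
      simp at this
      linarith
    · have := congrFun h 2
      simp at this
      linarith
    · have := congrFun h 3
      simp at this
      linarith
  · rintro ⟨a, b, c, d, h0, h1, h2, h3⟩
    refine ⟨a, _, ⟨b, _, ⟨c, _, ⟨d, rfl⟩, rfl⟩, rfl⟩, ?_⟩
    ext i
    fin_cases i <;> simp [h0, h1, h2, h3] <;> ring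

theorem preceq_phi_iff (x y : Fin 4 → ℤ) :
    preceq (phi x) (phi y) ↔
      x 0 ^ 2 + x 1 ^ 2 + x 2 ^ 2 + x 3 ^ 2 ≤ y 0 ^ 2 + y 1 ^ 2 + y 2 ^ 2 + y 3 ^ 2 ∧
      x 1 ^ 2 + x 2 ^ 2 + x 3 ^ 2 ≤ y 1 ^ 2 + y 2 ^ 2 + y 3 ^ 2 ∧
      x 2 ^ 2 + x 3 ^ 2 ≤ y 2 ^ 2 + y 3 ^ 2 ∧ x 3 ^ 2 ≤ y 3 ^ 2 := by
  simp only [preceq, phi, Fin.forall_fin_succ, Finset.sum_filter, Fin.sum_univ_four]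
  zify
  simp [sq_abs]

theorem sq_le_sq_of_le_or_le_neg {k x : ℤ} (hk : 0 ≤ k) (h : k ≤ x ∨ x ≤ -k) :
    k ^ 2 ≤ x ^ 2 := by
  rcases h with h | h <;> nlinarith

theorem mem_Icc_of_sq_le_sq {k x : ℤ} (hk : 0 ≤ k) (h : x ^ 2 ≤ k ^ 2) : -k ≤ x ∧ x ≤ k :=
  abs_le.mp (abs_le_of_sq_le_sq h hk)

theorem coset_dichotomy {w : Fin 4 → ℤ} (hw : w - v 1 ∈ M) :
    (9 ≤ w 3 ^ 2 ∧ preceq (phi (v 1)) (phi w) ∧ (preceq (phi w) (phi (v 1)) → w = v 1)) ∨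
    (24 ≤ w 0 ^ 2 + w 1 ^ 2 + w 2 ^ 2 + w 3 ^ 2 ∧ preceq (phi ![4, 2, 2, 0]) (phi w) ∧
      (preceq (phi w) (phi ![4, 2, 2, 0]) → w = ![4, 2, 2, 0])) := by
  obtain ⟨a, b, c, d, h0, h1, h2, h3⟩ := (sub_v_one_mem_M_iff w).mp hw
  simp only [preceq_phi_iff, v]
  simp
  rcases Int.even_or_odd' (a + b + c + d) with ⟨k, hk | hk⟩
  · left
    have q0 := sq_le_sq_of_le_or_le_neg (k := 1) (x := w 0) (by norm_num) (by omega)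
    have q1 := sq_le_sq_of_le_or_le_neg (k := 1) (x := w 1) (by norm_num) (by omega)
    have q2 := sq_le_sq_of_le_or_le_neg (k := 1) (x := w 2) (by norm_num) (by omega)
    have q3 := sq_le_sq_of_le_or_le_neg (k := 3) (x := w 3) (by norm_num) (by omega)
    refine ⟨by linarith, ⟨by linarith, by linarith, by linarith, by linarith⟩, ?_⟩
    intro r0 r1 r2 r3
    have p0 := mem_Icc_of_sq_le_sq (k := 1) (x := w 0) (by norm_num) (by linarith)
    have p1 := mem_Icc_of_sq_le_sq (k := 1) (x := w 1) (by norm_num) (by linarith)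
    have p2 := mem_Icc_of_sq_le_sq (k := 1) (x := w 2) (by norm_num) (by linarith)
    have p3 := mem_Icc_of_sq_le_sq (k := 3) (x := w 3) (by norm_num) (by linarith)
    ext i
    fin_cases i <;> simp <;> omega
  · right
    have q0 := sq_le_sq_of_le_or_le_neg (k := 2) (x := w 0) (by norm_num) (by omega)
    have q1 := sq_le_sq_of_le_or_le_neg (k := 2) (x := w 1) (by norm_num) (by omega)
    have q2 := sq_le_sq_of_le_or_le_neg (k := 2) (x := w 2) (by norm_num) (by omega)
    have q3 := sq_nonneg (w 3)
    have total : 24 ≤ w 0 ^ 2 + w 1 ^ 2 + w 2 ^ 2 + w 3 ^ 2 := by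
      have large : (4 ≤ w 0 ∨ w 0 ≤ -4) ∨ (4 ≤ w 1 ∨ w 1 ≤ -4) ∨ (4 ≤ w 2 ∨ w 2 ≤ -4) ∨
          (4 ≤ w 3 ∨ w 3 ≤ -4) := by omega
      rcases large with h | h | h | h <;>
        linarith [sq_le_sq_of_le_or_le_neg (by norm_num) h]
    refine ⟨total, ⟨by linarith, by linarith, by linarith, by linarith⟩, ?_⟩
    intro r0 r1 r2 r3
    have p0 := mem_Icc_of_sq_le_sq (k := 4) (x := w 0) (by norm_num) (by linarith)
    have p1 := mem_Icc_of_sq_le_sq (k := 2) (x := w 1) (by norm_num) (by nlinarith)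
    have p2 := mem_Icc_of_sq_le_sq (k := 2) (x := w 2) (by norm_num) (by nlinarith)
    ext i
    fin_cases i <;> simp <;> omega

/-- The minimal vectors of the coset `v₁ + M` with respect to `≺` are exactly
`v₁ = (1,−1,−1,3)` and `v₅ = (4,2,2,0)`. -/
theorem minimal_vectors_class_v1 (w : Fin 4 → ℤ) (hw : w - v 1 ∈ M) :
    (¬ ∃ w' : Fin 4 → ℤ, w' - v 1 ∈ M ∧ precl (phi w') (phi w)) ↔
      (w = v 1 ∨ w = ![4, 2, 2, 0]) := by
  constructor
  · intro hmin
    rcases coset_dichotomy hw with ⟨-, hle, heq⟩ | ⟨-, hle, heq⟩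
    · left
      by_contra hne
      exact hmin ⟨v 1, by simp, hle, fun h => hne (heq h)⟩
    · right
      by_contra hne
      refine hmin ⟨![4, 2, 2, 0], ?_, hle, fun h => hne (heq h)⟩
      exact (sub_v_one_mem_M_iff _).mpr ⟨0, 0, 0, 1, by simp⟩
  · rintro (rfl | rfl) ⟨w', hw', hle, hnot⟩
    · rcases coset_dichotomy hw' with ⟨-, h, -⟩ | ⟨h, -, -⟩
      · exact hnot h
      · have := ((preceq_phi_iff _ _).mp hle).1
        simp [v] at this
        omega
    · rcases coset_dichotomy hw' with ⟨h, -, -⟩ | ⟨-, h, -⟩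
      · have := ((preceq_phi_iff _ _).mp hle).2.2.2
        simp at this
        simp [this] at h
      · exact hnot h
end
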